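/- (Truth Lemma) For every (Λ,f) ∈ W^c and every formula φ ∈ 𝔏: M^c,(Λ,f) ⊨ φ if and only if φ ∈ Λ, where satisfaction in M^c is evaluated using the pointwise-intersection neighbourhood functions N^c_G obtained from the N^c_i. -/

import Mathlib

attribute [local instance] Classical.propDecidable

/-- Formulas of the multi-modal language 𝔏: atoms, ⊥, ¬, ∨, and □_G for
finite nonempty G ⊆ I. -/
inductive Form (I : Type) : Type
  | atom : ℕ → Form I
  | bot  : Form I
  | neg  : Form I → Form I
  | or   : Form I → Form I → Form I
  | box  : (G : Finset I) → G.Nonempty → Form I → Form I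

namespace Form
variable {I : Type}
/-- φ ∧ ψ -/
def and (φ ψ : Form I) : Form I := .neg (.or (.neg φ) (.neg ψ))
/-- φ → ψ -/
def imp (φ ψ : Form I) : Form I := .or (.neg φ) ψ
/-- ⊤ -/
def top : Form I := .neg .bot
/-- φ ↔ ψ -/
def iff (φ ψ : Form I) : Form I := (φ.imp ψ).and (ψ.imp φ)
end Form

/-- The pointwise-intersection neighbourhood function:
`N_G(w) = { ⋂_{i∈G} X_i : X_i ∈ N_i(w) }`. -/
def ptwInter {I W : Type} (N : I → W → Set (Set W)) (G : Finset I) (w : W) :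
    Set (Set W) :=
  { X | ∃ Y : I → Set W, (∀ i ∈ G, Y i ∈ N i w) ∧ X = ⋂ i ∈ G, Y i }

/-- Satisfaction at a world, relative to neighbourhood functions `N` and a
valuation `V`. -/
def satN {I W : Type} (N : I → W → Set (Set W)) (V : ℕ → Set W) :
    Form I → W → Prop
  | .atom n, w => w ∈ V n
  | .bot, _ => False
  | .neg φ, w => ¬ satN N V φ w
  | .or φ ψ, w => satN N V φ w ∨ satN N V ψ w
  | .box G _ φ, w => { v | satN N V φ v } ∈ ptwInter N G w

/-- A neighbourhood model. -/
structure NbhModel (I : Type) where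
  W : Type
  ne : Nonempty W
  N : I → W → Set (Set W)
  V : ℕ → Set W

/-- Truth in a model. -/
def NbhModel.sat {I : Type} (M : NbhModel I) (w : M.W) (φ : Form I) : Prop :=
  satN M.N M.V φ w

/-- Propositional evaluation treating atoms and boxed formulas as atomic. -/
def evalP {I : Type} (v : Form I → Prop) : Form I → Prop
  | .atom n => v (.atom n)
  | .bot => False
  | .neg φ => ¬ evalP v φ
  | .or φ ψ => evalP v φ ∨ evalP v ψ
  | .box G h φ => v (.box G h φ)

/-- Classical propositional tautologies (in the extended modal language). -/
def Tautology {I : Type} (φ : Form I) : Prop := ∀ v, evalP v φ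

theorem unionNE {I : Type} [DecidableEq I] {G H : Finset I}
    (hG : G.Nonempty) : (G ∪ H).Nonempty :=
  hG.mono Finset.subset_union_left

/-- Axiom schema B1: `(□_Gφ ∧ □_Hψ) → □_{G∪H}(φ∧ψ)` for disjoint G, H. -/
def B1Ax (I : Type) [DecidableEq I] : Set (Form I) :=
  { χ | ∃ (G H : Finset I) (hG : G.Nonempty) (hH : H.Nonempty) (φ ψ : Form I),
      Disjoint G H ∧
      χ = ((Form.box G hG φ).and (Form.box H hH ψ)).imp
            (Form.box (G ∪ H) (unionNE hG) (φ.and ψ)) }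

/-- Axiom schema B2: `□_{G∪H}⊤ → □_G⊤`. -/
def B2Ax (I : Type) [DecidableEq I] : Set (Form I) :=
  { χ | ∃ (G H : Finset I) (hG : G.Nonempty) (_hH : H.Nonempty),
      χ = (Form.box (G ∪ H) (unionNE hG) Form.top).imp (Form.box G hG Form.top) }

/-- Axiom schema B3: `(□_Gφ ∧ □_{G∪H∪J}φ) → □_{G∪H}φ`. -/
def B3Ax (I : Type) [DecidableEq I] : Set (Form I) :=
  { χ | ∃ (G H J : Finset I) (hG : G.Nonempty) (_hH : H.Nonempty)
      (_hJ : J.Nonempty) (φ : Form I),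
      χ = ((Form.box G hG φ).and (Form.box (G ∪ H ∪ J) (unionNE (unionNE hG)) φ)).imp
            (Form.box (G ∪ H) (unionNE hG) φ) }

/-- Axiom schema B4: `(□_Gφ ∧ □_H(φ∨ψ)) → □_{G∪H}φ`. -/
def B4Ax (I : Type) [DecidableEq I] : Set (Form I) :=
  { χ | ∃ (G H : Finset I) (hG : G.Nonempty) (hH : H.Nonempty) (φ ψ : Form I),
      χ = ((Form.box G hG φ).and (Form.box H hH (φ.or ψ))).imp
            (Form.box (G ∪ H) (unionNE hG) φ) }

/-- The axioms of the base logic. -/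
def BaseAx (I : Type) [DecidableEq I] : Set (Form I) :=
  B1Ax I ∪ B2Ax I ∪ B3Ax I ∪ B4Ax I

/-- Hilbert-style provability from classical tautologies and the axioms in
`Ax`, closed under modus ponens and replacement of equivalents. -/
inductive Prv {I : Type} (Ax : Set (Form I)) : Form I → Prop
  | taut {φ : Form I} : Tautology φ → Prv Ax φ
  | ax {φ : Form I} : φ ∈ Ax → Prv Ax φ
  | mp {φ ψ : Form I} : Prv Ax (φ.imp ψ) → Prv Ax φ → Prv Ax ψ
  | re {φ ψ : Form I} (G : Finset I) (hG : G.Nonempty) :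
      Prv Ax (φ.iff ψ) → Prv Ax ((Form.box G hG φ).iff (Form.box G hG ψ))

/-- `Γ ⊢ φ` iff there are `ψ₁,…,ψₙ ∈ Γ` with `⊢ (ψ₁∧…∧ψₙ) → φ`. -/
def Deduces {I : Type} (Ax : Set (Form I)) (Γ : Set (Form I)) (φ : Form I) :
    Prop :=
  ∃ l : List (Form I), (∀ ψ ∈ l, ψ ∈ Γ) ∧
    Prv Ax ((l.foldr Form.and Form.top).imp φ)

/-- Semantic consequence over a class of models. -/
def SemConseq {I : Type} (C : NbhModel I → Prop) (Γ : Set (Form I))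
    (φ : Form I) : Prop :=
  ∀ M : NbhModel I, C M → ∀ w : M.W, (∀ ψ ∈ Γ, M.sat w ψ) → M.sat w φ

/-- Soundness and strong completeness of `Ax` w.r.t. the class `C`. -/
def SoundComplete {I : Type} (Ax : Set (Form I)) (C : NbhModel I → Prop) :
    Prop :=
  ∀ (Γ : Set (Form I)) (φ : Form I), Deduces Ax Γ φ ↔ SemConseq C Γ φ

/-- A set of formulas is consistent iff it does not derive ⊥. -/
def ConsistentSet {I : Type} (Ax : Set (Form I)) (Γ : Set (Form I)) : Prop :=
  ¬ Deduces Ax Γ Form.bot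

/-- Maximal consistent sets. -/
def MCS {I : Type} (Ax : Set (Form I)) (Λ : Set (Form I)) : Prop :=
  ConsistentSet Ax Λ ∧ ∀ φ ∉ Λ, ¬ ConsistentSet Ax (insert φ Λ)

/-- 𝔾: the finite nonempty subsets of I. -/
def GG (I : Type) := { G : Finset I // G.Nonempty }

/-- 𝔽: the functions f : 𝔾 × 𝔏 → I with f(G,φ) ∈ G. -/
def FF (I : Type) := { f : GG I × Form I → I // ∀ p : GG I × Form I, f p ∈ p.1.1 }

/-- W^c: the canonical worlds (Λ,f) with Λ an MCS of the base logic and f ∈ 𝔽. -/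
def Wc (I : Type) [DecidableEq I] := { p : Set (Form I) × FF I // MCS (BaseAx I) p.1 }

/-- The sets X^{G,φ}_i = {(Λ,f) ∈ W^c : φ ∈ Λ or f(G,φ) ≠ i}. -/
def Xset {I : Type} [DecidableEq I] (G : GG I) (φ : Form I) (i : I) :
    Set (Wc I) :=
  { w | φ ∈ w.1.1 ∨ (w.1.2).1 (G, φ) ≠ i }

/-- The canonical neighbourhood functions N^c_i. -/
def Nc {I : Type} [DecidableEq I] (i : I) (w : Wc I) : Set (Set (Wc I)) :=
  { X | ∃ (G : GG I) (φ : Form I),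
      Form.box G.1 G.2 φ ∈ w.1.1 ∧ i ∈ G.1 ∧ X = Xset G φ i }

/-- The canonical valuation V^c. -/
def Vc {I : Type} [DecidableEq I] (n : ℕ) : Set (Wc I) :=
  { w | Form.atom n ∈ w.1.1 }

section PropositionalReasoning

variable {I : Type}

@[simp] theorem evalP_and (v : Form I → Prop) (φ ψ : Form I) :
    evalP v (φ.and ψ) ↔ evalP v φ ∧ evalP v ψ := by
  simp [Form.and, evalP]

@[simp] theorem evalP_imp (v : Form I → Prop) (φ ψ : Form I) :
    evalP v (φ.imp ψ) ↔ (evalP v φ → evalP v ψ) := by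
  simp [Form.imp, evalP, imp_iff_not_or]

@[simp] theorem evalP_iff (v : Form I → Prop) (φ ψ : Form I) :
    evalP v (φ.iff ψ) ↔ (evalP v φ ↔ evalP v ψ) := by
  simp only [Form.iff, evalP_and, evalP_imp, iff_def]

@[simp] theorem evalP_top (v : Form I → Prop) : evalP v Form.top := by
  simp [Form.top, evalP]

@[simp] theorem evalP_foldr_and (v : Form I → Prop) (l : List (Form I)) :
    evalP v (l.foldr Form.and Form.top) ↔ ∀ ψ ∈ l, evalP v ψ := by
  induction l <;> simp_all

theorem Prv.taut_consequence {Ax : Set (Form I)} {φ ψ : Form I} (h : Prv Ax φ)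
    (hv : ∀ v, evalP v φ → evalP v ψ) : Prv Ax ψ :=
  .mp (.taut fun v => by simpa using hv v) h

theorem Prv.taut_consequence₂ {Ax : Set (Form I)} {φ ψ χ : Form I} (h₁ : Prv Ax φ)
    (h₂ : Prv Ax ψ) (hv : ∀ v, evalP v φ → evalP v ψ → evalP v χ) : Prv Ax χ :=
  .mp (h₁.taut_consequence fun v => by simpa using hv v) h₂

theorem Deduces.neg_of_insert {Ax Γ : Set (Form I)} {φ : Form I}
    (h : Deduces Ax (insert φ Γ) Form.bot) : Deduces Ax Γ φ.neg := by
  obtain ⟨l, hl, hp⟩ := h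
  refine ⟨l.filter (· ≠ φ), fun ψ hψ => ?_, hp.taut_consequence fun v => ?_⟩
  · simp only [List.mem_filter, decide_eq_true_eq] at hψ
    exact (hl ψ hψ.1).resolve_left hψ.2
  · simp only [evalP_imp, evalP_foldr_and, evalP, List.mem_filter, decide_eq_true_eq]
    intro h₁ h₂ h₃
    refine h₁ fun ψ hψ => ?_
    by_cases hc : ψ = φ
    · exact hc ▸ h₃
    · exact h₂ ψ ⟨hψ, hc⟩

theorem Deduces.taut_consequence₂ {Ax Γ : Set (Form I)} {φ ψ χ : Form I}
    (h₁ : Deduces Ax Γ φ) (h₂ : Deduces Ax Γ ψ)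
    (hv : ∀ v, evalP v φ → evalP v ψ → evalP v χ) : Deduces Ax Γ χ := by
  obtain ⟨l, hl, hp⟩ := h₁
  obtain ⟨m, hm, hq⟩ := h₂
  refine ⟨l ++ m, fun ψ hψ => (List.mem_append.1 hψ).elim (hl ψ) (hm ψ),
    hp.taut_consequence₂ hq fun v => ?_⟩
  simp only [evalP_imp, evalP_foldr_and, List.mem_append]
  exact fun a b c => hv v (a fun ψ h => c ψ (.inl h)) (b fun ψ h => c ψ (.inr h))

theorem Deduces.of_mem {Ax Γ : Set (Form I)} {φ : Form I} (h : φ ∈ Γ) : Deduces Ax Γ φ :=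
  ⟨[φ], by simpa using h, .taut fun v => by simp⟩

theorem Deduces.of_prv {Ax : Set (Form I)} (Γ : Set (Form I)) {φ : Form I}
    (h : Prv Ax φ) : Deduces Ax Γ φ :=
  ⟨[], by simp, h.taut_consequence fun v => by simp⟩

end PropositionalReasoning

namespace MCS

variable {I : Type} {Ax Λ : Set (Form I)}

theorem mem_of_deduces (hΛ : MCS Ax Λ) {φ : Form I} (h : Deduces Ax Λ φ) : φ ∈ Λ := by
  by_contra hφ
  exact hΛ.1 (h.taut_consequence₂ (Deduces.neg_of_insert (not_not.1 (hΛ.2 φ hφ)))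
    fun v h₁ h₂ => (h₂ h₁).elim)

theorem mem_of_prv (hΛ : MCS Ax Λ) {φ : Form I} (h : Prv Ax φ) : φ ∈ Λ :=
  hΛ.mem_of_deduces (.of_prv Λ h)

theorem neg_mem_iff (hΛ : MCS Ax Λ) {φ : Form I} : φ.neg ∈ Λ ↔ φ ∉ Λ :=
  ⟨fun h₁ h₂ => hΛ.1 ((Deduces.of_mem h₁).taut_consequence₂ (.of_mem h₂)
      fun _ a b => (a b).elim),
    fun h => hΛ.mem_of_deduces (Deduces.neg_of_insert (not_not.1 (hΛ.2 φ h)))⟩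

theorem or_mem_iff (hΛ : MCS Ax Λ) {φ ψ : Form I} : φ.or ψ ∈ Λ ↔ φ ∈ Λ ∨ ψ ∈ Λ := by
  constructor
  · intro h
    by_contra! hc
    have h₁ : φ.neg ∈ Λ := hΛ.neg_mem_iff.2 hc.1
    exact hc.2 (hΛ.mem_of_deduces ((Deduces.of_mem h).taut_consequence₂ (.of_mem h₁)
      fun _ a b => a.resolve_left b))
  · rintro (h | h)
    · exact hΛ.mem_of_deduces ((Deduces.of_mem h).taut_consequence₂ (.of_mem h)
        fun _ a _ => .inl a)
    · exact hΛ.mem_of_deduces ((Deduces.of_mem h).taut_consequence₂ (.of_mem h)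
        fun _ a _ => .inr a)

theorem bot_notMem (hΛ : MCS Ax Λ) : Form.bot ∉ Λ := fun h => hΛ.1 (.of_mem h)

theorem top_mem (hΛ : MCS Ax Λ) : Form.top ∈ Λ := hΛ.neg_mem_iff.2 hΛ.bot_notMem

theorem and_mem_iff (hΛ : MCS Ax Λ) {φ ψ : Form I} : φ.and ψ ∈ Λ ↔ φ ∈ Λ ∧ ψ ∈ Λ := by
  simp [Form.and, hΛ.neg_mem_iff, hΛ.or_mem_iff]

theorem imp_mem_iff (hΛ : MCS Ax Λ) {φ ψ : Form I} :
    φ.imp ψ ∈ Λ ↔ (φ ∈ Λ → ψ ∈ Λ) := by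
  simp [Form.imp, hΛ.neg_mem_iff, hΛ.or_mem_iff, imp_iff_not_or]

theorem iff_mem_iff (hΛ : MCS Ax Λ) {φ ψ : Form I} :
    φ.iff ψ ∈ Λ ↔ (φ ∈ Λ ↔ ψ ∈ Λ) := by
  simp only [Form.iff, hΛ.and_mem_iff, hΛ.imp_mem_iff, iff_def]

end MCS

section Lindenbaum

variable {I : Type} {Ax : Set (Form I)}

theorem ConsistentSet.sUnion_of_isChain {c : Set (Set (Form I))}
    (hc : ∀ Γ ∈ c, ConsistentSet Ax Γ) (hchain : IsChain (· ⊆ ·) c) (hne : c.Nonempty) :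
    ConsistentSet Ax (⋃₀ c) := by
  rintro ⟨l, hl, hp⟩
  have key : ∃ Γ ∈ c, ∀ ψ ∈ l, ψ ∈ Γ := by
    clear hp
    induction l with
    | nil => exact hne.imp fun Γ hΓ => ⟨hΓ, by simp⟩
    | cons a l ih =>
      obtain ⟨Γ, hΓ, hlΓ⟩ := ih fun ψ hψ => hl ψ (List.mem_cons_of_mem _ hψ)
      obtain ⟨Δ, hΔ, haΔ⟩ := hl a List.mem_cons_self
      rcases hchain.total hΓ hΔ with h | h
      · exact ⟨Δ, hΔ, by simpa [haΔ] using fun ψ hψ => h (hlΓ ψ hψ)⟩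
      · exact ⟨Γ, hΓ, by simpa [h haΔ] using hlΓ⟩
  obtain ⟨Γ, hΓ, hlΓ⟩ := key
  exact hc Γ hΓ ⟨l, hlΓ, hp⟩

theorem ConsistentSet.exists_mcs {Γ : Set (Form I)} (hΓ : ConsistentSet Ax Γ) :
    ∃ Λ, Γ ⊆ Λ ∧ MCS Ax Λ := by
  obtain ⟨Λ, hsub, hmax⟩ := zorn_subset_nonempty {Δ | ConsistentSet Ax Δ}
    (fun c hc hchain hne => ⟨⋃₀ c, ConsistentSet.sUnion_of_isChain hc hchain hne,
      fun _ => Set.subset_sUnion_of_mem⟩) Γ hΓ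
  exact ⟨Λ, hsub, hmax.prop, fun φ hφ hcon =>
    hφ (hmax.le_of_ge hcon (Set.subset_insert φ Λ) (Set.mem_insert φ Λ))⟩

theorem Prv.of_forall_mcs {φ : Form I} (h : ∀ Λ, MCS Ax Λ → φ ∈ Λ) : Prv Ax φ := by
  by_contra hφ
  have hcon : ConsistentSet Ax {φ.neg} := by
    rintro ⟨l, hl, hp⟩
    refine hφ (hp.taut_consequence fun v => ?_)
    simp only [evalP_imp, evalP_foldr_and]
    intro h₁
    by_contra h₂
    exact h₁ fun ψ hψ => hl ψ hψ ▸ h₂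
  obtain ⟨Λ, hsub, hΛ⟩ := hcon.exists_mcs
  exact hΛ.neg_mem_iff.1 (hsub rfl) (h Λ hΛ)

end Lindenbaum

/-- `G` is nonempty and `□_G φ ∈ Λ`. -/
def BoxMem {I : Type} (Λ : Set (Form I)) (G : Finset I) (φ : Form I) : Prop :=
  ∃ h : G.Nonempty, Form.box G h φ ∈ Λ

namespace BoxMem

variable {I : Type}

theorem congr {Ax Λ : Set (Form I)} (hΛ : MCS Ax Λ) {G : Finset I} {φ ψ : Form I}
    (h : BoxMem Λ G φ) (heq : ∀ Δ, MCS Ax Δ → (φ ∈ Δ ↔ ψ ∈ Δ)) : BoxMem Λ G ψ := by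
  obtain ⟨hG, h⟩ := h
  have hp : Prv Ax (φ.iff ψ) := .of_forall_mcs fun Δ hΔ => hΔ.iff_mem_iff.2 (heq Δ hΔ)
  exact ⟨hG, (hΛ.iff_mem_iff.1 (hΛ.mem_of_prv (.re G hG hp))).1 h⟩

variable [DecidableEq I] {Λ : Set (Form I)} {G H : Finset I} {φ ψ : Form I}

theorem union_and (hΛ : MCS (BaseAx I) Λ) (hd : Disjoint G H) (h₁ : BoxMem Λ G φ)
    (h₂ : BoxMem Λ H ψ) : BoxMem Λ (G ∪ H) (φ.and ψ) := by
  obtain ⟨hG, h₁⟩ := h₁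
  obtain ⟨hH, h₂⟩ := h₂
  exact ⟨unionNE hG, hΛ.imp_mem_iff.1 (hΛ.mem_of_prv (.ax
    (.inl (.inl (.inl ⟨G, H, hG, hH, φ, ψ, hd, rfl⟩))))) (hΛ.and_mem_iff.2 ⟨h₁, h₂⟩)⟩

theorem top_of_subset (hΛ : MCS (BaseAx I) Λ) (hG : G.Nonempty) (hs : G ⊆ H)
    (h : BoxMem Λ H Form.top) : BoxMem Λ G Form.top := by
  rw [← Finset.union_eq_right.2 hs] at h
  exact ⟨hG, hΛ.imp_mem_iff.1 (hΛ.mem_of_prv (.ax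
    (.inl (.inl (.inr ⟨G, H, hG, hG.mono hs, rfl⟩))))) h.2⟩

theorem of_subset_of_subset (hΛ : MCS (BaseAx I) Λ) {J : Finset I} (hGH : G ⊆ H)
    (hHJ : H ⊆ J) (h₁ : BoxMem Λ G φ) (h₂ : BoxMem Λ J φ) : BoxMem Λ H φ := by
  obtain ⟨hG, h₁⟩ := h₁
  have hH := hG.mono hGH
  rw [← Finset.union_eq_right.2 hHJ, ← Finset.union_eq_right.2 hGH] at h₂
  have h := hΛ.imp_mem_iff.1 (hΛ.mem_of_prv (.ax
    (.inl (.inr ⟨G, H, J, hG, hH, hH.mono hHJ, φ, rfl⟩)))) (hΛ.and_mem_iff.2 ⟨h₁, h₂.2⟩)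
  have h' : BoxMem Λ (G ∪ H) φ := ⟨_, h⟩
  rwa [Finset.union_eq_right.2 hGH] at h'

theorem union_of_imp (hΛ : MCS (BaseAx I) Λ) (h₁ : BoxMem Λ G φ) (h₂ : BoxMem Λ H ψ)
    (himp : ∀ Δ, MCS (BaseAx I) Δ → φ ∈ Δ → ψ ∈ Δ) : BoxMem Λ (G ∪ H) φ := by
  obtain ⟨hH, h₂⟩ := h₂.congr (ψ := φ.or ψ) hΛ fun Δ hΔ => by
    rw [hΔ.or_mem_iff]
    exact ⟨.inr, fun h => h.elim (himp Δ hΔ) id⟩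
  obtain ⟨hG, h₁⟩ := h₁
  exact ⟨unionNE hG, hΛ.imp_mem_iff.1 (hΛ.mem_of_prv (.ax
    (.inr ⟨G, H, hG, hH, φ, ψ, rfl⟩))) (hΛ.and_mem_iff.2 ⟨h₁, h₂⟩)⟩

theorem union_biUnion_of_imp (hΛ : MCS (BaseAx I) Λ) {ι : Type*} {H : ι → Finset I}
    {ψ : ι → Form I} (K : Finset ι) (h₁ : BoxMem Λ G φ)
    (h₂ : ∀ i ∈ K, BoxMem Λ (H i) (ψ i))
    (himp : ∀ i ∈ K, ∀ Δ, MCS (BaseAx I) Δ → φ ∈ Δ → ψ i ∈ Δ) :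
    BoxMem Λ (G ∪ K.biUnion H) φ := by
  induction K using Finset.induction_on with
  | empty => simpa using h₁
  | insert a K _ ih =>
    have := union_of_imp hΛ (ih (fun i hi => h₂ i (Finset.mem_insert_of_mem hi))
      fun i hi => himp i (Finset.mem_insert_of_mem hi))
      (h₂ a (Finset.mem_insert_self a K)) (himp a (Finset.mem_insert_self a K))
    rwa [Finset.biUnion_insert, Finset.union_comm (H a), ← Finset.union_assoc]

theorem exists_biUnion (hΛ : MCS (BaseAx I) Λ) {ι : Type*} {H : ι → Finset I}
    {ψ : ι → Form I} {T : Finset ι} (hT : T.Nonempty)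
    (hd : (T : Set ι).PairwiseDisjoint H) (h : ∀ i ∈ T, BoxMem Λ (H i) (ψ i)) :
    ∃ χ, BoxMem Λ (T.biUnion H) χ ∧
      ∀ Δ, MCS (BaseAx I) Δ → (χ ∈ Δ ↔ ∀ i ∈ T, ψ i ∈ Δ) := by
  induction hT using Finset.Nonempty.cons_induction with
  | singleton a => exact ⟨ψ a, by simpa using h, by simp⟩
  | cons a T ha _ ih =>
    obtain ⟨χ, hχ, hiff⟩ := ih (hd.subset (by simp))
      fun i hi => h i (Finset.mem_cons_of_mem hi)
    refine ⟨(ψ a).and χ, ?_, fun Δ hΔ => ?_⟩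
    · rw [Finset.cons_eq_insert, Finset.biUnion_insert]
      refine union_and hΛ ?_ (h a (Finset.mem_cons_self a T)) hχ
      rw [Finset.disjoint_biUnion_right]
      exact fun i hi => hd (Finset.mem_coe.2 (Finset.mem_cons_self a T))
        (Finset.mem_coe.2 (Finset.mem_cons_of_mem hi)) fun e => ha (e ▸ hi)
    · simp [hΔ.and_mem_iff, hiff Δ hΔ]

end BoxMem

theorem FF.exists_apply_eq {I : Type} (q : GG I × Form I) {i : I} (hi : i ∈ q.1.1) :
    ∃ f : FF I, f.1 q = i := by
  have h : ∀ r : GG I × Form I, ∃ j ∈ r.1.1, r = q → j = i := fun r => by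
    by_cases hr : r = q
    · exact ⟨i, hr ▸ hi, fun _ => rfl⟩
    · exact r.1.2.imp fun j hj => ⟨hj, fun e => (hr e).elim⟩
  choose f hf hfq using h
  exact ⟨⟨f, hf⟩, hfq q rfl⟩

theorem FF.exists_forall_imp {I : Type} (P : GG I × Form I → I → Prop) :
    ∃ f : FF I, ∀ q, P q (f.1 q) → ∀ j ∈ q.1.1, P q j := by
  have h : ∀ q : GG I × Form I, ∃ j ∈ q.1.1, P q j → ∀ k ∈ q.1.1, P q k := fun q => by
    by_cases hq : ∀ k ∈ q.1.1, P q k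
    · exact q.1.2.imp fun j hj => ⟨hj, fun _ => hq⟩
    · push Not at hq
      exact hq.imp fun j hj => ⟨hj.1, fun hP => (hj.2 hP).elim⟩
  choose f hf hfP using h
  exact ⟨⟨f, hf⟩, hfP⟩

/-- If the sets `Xset (p i).1 (p i).2 i`, `i ∈ G`, intersect in the truth set of `φ` and every
`□_{G_i} ψ_i` belongs to `Λ`, where `p i = (G_i, ψ_i)`, then so does `□_G φ`. -/
theorem BoxMem.of_forall_mem_iff {I : Type} [DecidableEq I] {Λ : Set (Form I)}
    (hΛ : MCS (BaseAx I) Λ) {G : Finset I} (hG : G.Nonempty) {φ : Form I}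
    {p : I → GG I × Form I} (hbox : ∀ i ∈ G, BoxMem Λ (p i).1.1 (p i).2)
    (hmem : ∀ i ∈ G, i ∈ (p i).1.1)
    (hφ : ∀ Δ, MCS (BaseAx I) Δ → ∀ f : FF I,
      (φ ∈ Δ ↔ ∀ i ∈ G, (p i).2 ∈ Δ ∨ f.1 (p i) ≠ i)) : BoxMem Λ G φ := by
  have himp : ∀ i ∈ G, ∀ Δ, MCS (BaseAx I) Δ → φ ∈ Δ → (p i).2 ∈ Δ := by
    intro i hi Δ hΔ h
    obtain ⟨f, hf⟩ := FF.exists_apply_eq (p i) (hmem i hi)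
    exact ((hφ Δ hΔ f).1 h i hi).resolve_right (not_not.2 hf)
  have hsub : G ⊆ G.biUnion fun i => (p i).1.1 := fun i hi =>
    Finset.mem_biUnion.2 ⟨i, hi, hmem i hi⟩
  -- The pairs all of whose agents are sent to that same pair; only these constrain `φ`.
  let T := (G.image p).filter fun q => ∀ j ∈ q.1.1, j ∈ G ∧ p j = q
  have hT : ∀ q ∈ T, (∃ i ∈ G, p i = q) ∧ ∀ j ∈ q.1.1, j ∈ G ∧ p j = q := fun q hq => by
    simpa only [T, Finset.mem_filter, Finset.mem_image] using hq
  have hφT : ∀ Δ, MCS (BaseAx I) Δ → (φ ∈ Δ ↔ ∀ q ∈ T, q.2 ∈ Δ) := by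
    intro Δ hΔ
    obtain ⟨f, hf⟩ := FF.exists_forall_imp fun q j => j ∈ G ∧ p j = q
    rw [hφ Δ hΔ f]
    constructor
    · intro h q hq
      obtain ⟨hj, hpj⟩ := (hT q hq).2 _ (f.2 q)
      have := h _ hj
      rw [hpj] at this
      exact this.resolve_right (not_not.2 rfl)
    · intro h i hi
      by_cases hfi : f.1 (p i) = i
      · refine .inl (h _ (Finset.mem_filter.2 ⟨Finset.mem_image_of_mem p hi, ?_⟩))
        exact hf (p i) (by rw [hfi]; exact ⟨hi, rfl⟩)
      · exact .inr hfi
  rcases T.eq_empty_or_nonempty with hemp | hne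
  · have hall : ∀ Δ, MCS (BaseAx I) Δ → φ ∈ Δ := fun Δ hΔ => (hφT Δ hΔ).2 (by simp [hemp])
    have heq : ∀ Δ, MCS (BaseAx I) Δ → (φ ∈ Δ ↔ Form.top ∈ Δ) := fun Δ hΔ =>
      iff_of_true (hall Δ hΔ) hΔ.top_mem
    obtain ⟨i, hi⟩ := hG
    have hi' : BoxMem Λ (p i).1.1 φ := (hbox i hi).congr hΛ fun Δ hΔ =>
      iff_of_true (himp i hi Δ hΔ (hall Δ hΔ)) (hall Δ hΔ)
    have hU := (hi'.union_biUnion_of_imp hΛ G hbox himp).congr hΛ heq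
    exact (hU.top_of_subset hΛ ⟨i, hi⟩ (hsub.trans Finset.subset_union_right)).congr hΛ
      fun Δ hΔ => (heq Δ hΔ).symm
  · obtain ⟨χ, hχ, hiff⟩ := BoxMem.exists_biUnion hΛ (H := fun q : GG I × Form I => q.1.1)
      (ψ := Prod.snd) hne
      (fun q hq r hr hqr => Finset.disjoint_left.2 fun j hj hj' =>
        hqr (((hT q hq).2 j hj).2.symm.trans ((hT r hr).2 j hj').2))
      (fun q hq => by
        obtain ⟨i, hi, rfl⟩ := (hT q hq).1
        exact hbox i hi)
    have hφU := hχ.congr hΛ fun Δ hΔ => (hiff Δ hΔ).trans (hφT Δ hΔ).symm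
    refine BoxMem.of_subset_of_subset hΛ ?_ (hsub.trans Finset.subset_union_right) hφU
      (hφU.union_biUnion_of_imp hΛ G hbox himp)
    intro j hj
    obtain ⟨q, hq, hjq⟩ := Finset.mem_biUnion.1 hj
    exact ((hT q hq).2 j hjq).1

theorem setOf_mem_mem_ptwInter_Nc {I : Type} [DecidableEq I] (w : Wc I) (G : Finset I)
    (hG : G.Nonempty) (φ : Form I) :
    {v : Wc I | φ ∈ v.1.1} ∈ ptwInter Nc G w ↔ Form.box G hG φ ∈ w.1.1 := by
  constructor
  · rintro ⟨Y, hY, heq⟩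
    have h : ∀ i, ∃ q : GG I × Form I, i ∈ G →
        BoxMem w.1.1 q.1.1 q.2 ∧ i ∈ q.1.1 ∧ Y i = Xset q.1 q.2 i := fun i => by
      by_cases hi : i ∈ G
      · obtain ⟨H, ψ, h₁, h₂, h₃⟩ := hY i hi
        exact ⟨(H, ψ), fun _ => ⟨⟨H.2, h₁⟩, h₂, h₃⟩⟩
      · exact ⟨(⟨G, hG⟩, φ), fun h => (hi h).elim⟩
    choose p hp using h
    refine (BoxMem.of_forall_mem_iff w.2 hG (fun i hi => (hp i hi).1)
      (fun i hi => (hp i hi).2.1) fun Δ hΔ f => ?_).2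
    refine (Set.ext_iff.1 heq ⟨(Δ, f), hΔ⟩).trans (Set.mem_iInter₂.trans ?_)
    refine forall₂_congr fun i hi => ?_
    rw [(hp i hi).2.2]
    rfl
  · intro h
    refine ⟨Xset ⟨G, hG⟩ φ, fun i hi => ⟨⟨G, hG⟩, φ, h, hi, rfl⟩, ?_⟩
    ext v
    simp only [Set.mem_iInter]
    exact ⟨fun hv i _ => .inl hv, fun hv =>
      (hv _ (v.1.2.2 (⟨G, hG⟩, φ))).resolve_right (not_not.2 rfl)⟩

/-- Truth Lemma: For every (Λ,f) ∈ W^c and every φ ∈ 𝔏,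
M^c,(Λ,f) ⊨ φ iff φ ∈ Λ, where satisfaction uses the pointwise-intersection
neighbourhood functions obtained from the N^c_i. -/
theorem truth_lemma (I : Type) [DecidableEq I] (w : Wc I) (φ : Form I) :
    satN (Nc (I := I)) (Vc (I := I)) φ w ↔ φ ∈ w.1.1 := by
  induction φ generalizing w with
  | atom n => rfl
  | bot => exact iff_of_false id w.2.bot_notMem
  | neg φ ih => exact (not_congr (ih w)).trans w.2.neg_mem_iff.symm
  | or φ ψ ih₁ ih₂ => exact (or_congr (ih₁ w) (ih₂ w)).trans w.2.or_mem_iff.symm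
  | box G hG φ ih =>
    have heq : {v | satN Nc Vc φ v} = {v : Wc I | φ ∈ v.1.1} := Set.ext ih
    rw [← setOf_mem_mem_ptwInter_Nc w G hG φ, ← heq]
    rfl
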